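/- There is no probability distribution μ over deterministic strategies — tuples (E₁, E₂, D) with E₁, E₂ : {0,1}² → {0,1} and D : {0,1} × {0,1} × {0,1}² → {0,1} — such that for every triple of input strings x₁, x₂, y ∈ {0,1}² satisfying the promise x₁⁰ ⊕ x₂⁰ ⊕ y⁰ = 0, the μ-probability that D(E₁(x₁), E₂(x₂), y) = f₂(x₁, x₂, y) equals 1. That is, even with classical shared randomness, f₂ cannot be computed exactly with one bit of communication from each sender. -/

import Mathlib

/-- `bitP r = 1` iff `r` is odd (the parity function ℙ). -/
def bitP (r : ℕ) : Bool := r % 2 == 1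

/-- The value of a bit as a natural number. -/
def b2n (b : Bool) : ℕ := cond b 1 0

/-- The function `f₂` of the CC₂ task:
`f₂(x₁,x₂,y) = x₁¹ ⊕ x₂¹ ⊕ y¹ ⊕ ℙ[(x₁⁰ + x₂⁰ + y⁰)/2]`. -/
def f2 (x1 x2 y : Bool × Bool) : Bool :=
  xor (xor (xor x1.2 x2.2) y.2) (bitP ((b2n x1.1 + b2n x2.1 + b2n y.1) / 2))

/-- The promise condition `x₁⁰ ⊕ x₂⁰ ⊕ y⁰ = 0`. -/
abbrev promise2 (x1 x2 y : Bool × Bool) : Prop :=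
  xor (xor x1.1 x2.1) y.1 = false

/-- A deterministic strategy: one-bit encodings `E₁, E₂` for the two senders
and a decoding `D` for the receiver (taking the two communicated bits and
the receiver's string `y`). -/
abbrev Strategy :=
  ((Bool × Bool) → Bool) × ((Bool × Bool) → Bool) × (Bool → Bool → Bool × Bool → Bool)

/-- An encoder used by a correct strategy separates the two strings with a given first bit. -/
lemma encoders_separate {s : Strategy}
    (hs : ∀ x1 x2 y, promise2 x1 x2 y → s.2.2 (s.1 x1) (s.2.1 x2) y = f2 x1 x2 y) (a : Bool) :
    s.1 (a, true) = !s.1 (a, false) ∧ s.2.1 (a, true) = !s.2.1 (a, false) := by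
  constructor
  · refine Bool.eq_not.2 fun h => ?_
    have h0 := hs (a, false) (false, false) (a, false) (by simp)
    have h1 := hs (a, true) (false, false) (a, false) (by simp)
    rw [h, h0] at h1
    revert h1
    cases a <;> decide
  · refine Bool.eq_not.2 fun h => ?_
    have h0 := hs (false, false) (a, false) (a, false) (by simp)
    have h1 := hs (false, false) (a, true) (a, false) (by simp)
    rw [h, h0] at h1
    revert h1
    cases a <;> decide

/-- Every deterministic strategy fails on some promise input. -/
lemma exists_promise2_ne_f2 (s : Strategy) :
    ∃ x1 x2 y, promise2 x1 x2 y ∧ s.2.2 (s.1 x1) (s.2.1 x2) y ≠ f2 x1 x2 y := by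
  by_contra! hs
  have enc1 (a : Bool) : ∃ b, s.1 (a, b) = false := by
    cases e : s.1 (a, false)
    · exact ⟨false, e⟩
    · exact ⟨true, by rw [(encoders_separate hs a).1, e]; rfl⟩
  have enc2 (a : Bool) : ∃ b, s.2.1 (a, b) = false := by
    cases e : s.2.1 (a, false)
    · exact ⟨false, e⟩
    · exact ⟨true, by rw [(encoders_separate hs a).2, e]; rfl⟩
  choose g hg using enc1
  choose k hk using enc2
  have h00 := hs (false, g false) (false, k false) (false, false) rfl
  have h11 := hs (true, g true) (true, k true) (false, false) rfl
  have h01 := hs (false, g false) (true, k true) (true, false) rfl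
  have h10 := hs (true, g true) (false, k false) (true, false) rfl
  rw [hg, hk] at h00 h11 h01 h10
  have e0 := h00.symm.trans h11
  have e1 := h01.symm.trans h10
  clear h00 h11 h01 h10 hg hk hs
  revert e0 e1
  generalize g false = a, g true = b, k false = c, k true = d
  revert a b c d
  decide

/-- A probability distribution is supported on every event of probability one. -/
lemma of_sum_filter_eq_one {α : Type*} [Fintype α] {μ : α → ℝ} (h0 : ∀ a, 0 ≤ μ a)
    (h1 : ∑ a, μ a = 1) (p : α → Prop) [DecidablePred p]
    (hp : ∑ a ∈ Finset.univ.filter p, μ a = 1) {a : α} (ha : μ a ≠ 0) : p a := by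
  by_contra hpa
  have hsum := Finset.sum_filter_add_sum_filter_not Finset.univ p μ
  have hzero : ∑ b ∈ Finset.univ.filter (fun b => ¬ p b), μ b = 0 := by linarith
  exact ha ((Finset.sum_eq_zero_iff_of_nonneg fun b _ => h0 b).1 hzero a (by simp [hpa]))

/-- Even with classical shared randomness (a probability distribution `μ` over
deterministic strategies), `f₂` cannot be computed exactly with one bit of
communication from each sender: there is no `μ` giving success probability `1`
on every promise input. -/
theorem no_shared_randomness_strategy_for_f2 :
    ¬ ∃ μ : Strategy → ℝ, (∀ s, 0 ≤ μ s) ∧ (∑ s, μ s = 1) ∧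
      ∀ x1 x2 y : Bool × Bool, promise2 x1 x2 y →
        (∑ s ∈ Finset.univ.filter
            (fun s : Strategy => s.2.2 (s.1 x1) (s.2.1 x2) y = f2 x1 x2 y),
          μ s) = 1 := by
  rintro ⟨μ, h0, h1, h⟩
  obtain ⟨s, -, hs⟩ := Finset.exists_ne_zero_of_sum_ne_zero (h1.trans_ne one_ne_zero)
  obtain ⟨x1, x2, y, hp, hne⟩ := exists_promise2_ne_f2 s
  exact hne (of_sum_filter_eq_one h0 h1 _ (h x1 x2 y hp) hs)
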